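/- Let n ≥ 1 and let f be a nonnegative integrable function on ℝ^n. If T_θ f = f − (∫ f dx)·θ belongs to the Hardy space H^1(ℝ^n) (i.e., 𝓜_φ(T_θ f) is integrable for every smooth φ supported in the closed unit ball with ∫φ = 1), then ∫_{ℝ^n} f(x)(1 + ln₊ f(x) + ln₊|x|) dx < ∞. -/

import Mathlib

open MeasureTheory Real Set Metric ENNReal

noncomputable section

/-- `ℝ^n` with the Euclidean norm. -/
abbrev En (n : ℕ) := EuclideanSpace ℝ (Fin n)

/-- `ln₊ t = max (ln t) 0`. -/
def lnp (t : ℝ) : ℝ := max (Real.log t) 0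

/-- The unit cube `Q = (-1/2, 1/2)^n`. -/
def unitQ (n : ℕ) : Set (En n) := {x | ∀ i, -(1/2 : ℝ) < x i ∧ x i < 1/2}

/-- The dilate `φ_t(y) = t^{-n} φ(y/t)` convolved with `f` at `x`:
`(φ_t ∗ f)(x) = ∫ t^{-n} φ((x-y)/t) f(y) dy`. -/
def phiConv (n : ℕ) (φ f : En n → ℝ) (t : ℝ) (x : En n) : ℝ :=
  ∫ y, (t ^ n)⁻¹ * φ (t⁻¹ • (x - y)) * f y

/-- The maximal function `𝓜_φ f(x) = sup_{t>0} |(φ_t ∗ f)(x)|`. -/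
def Mphi (n : ℕ) (φ f : En n → ℝ) (x : En n) : ℝ :=
  ⨆ t : {t : ℝ // 0 < t}, |phiConv n φ f t.1 x|

/-- A smooth function supported in the closed unit ball with integral `1`. -/
def IsTestFun (n : ℕ) (φ : En n → ℝ) : Prop :=
  ContDiff ℝ (⊤ : ℕ∞) φ ∧ (∀ x, x ∉ Metric.closedBall (0 : En n) 1 → φ x = 0) ∧ (∫ x, φ x) = 1

/-- Membership in the Hardy space `H^1(ℝ^n)`: the maximal function `𝓜_φ f` is
integrable for every admissible `φ`. -/
def MemH1 (n : ℕ) (f : En n → ℝ) : Prop :=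
  ∀ φ : En n → ℝ, IsTestFun n φ → Integrable (Mphi n φ f)

open Filter Topology

lemma exists_bump (n : ℕ) : ∃ (φ : En n → ℝ) (A : ℝ), IsTestFun n φ ∧ 0 < A ∧ Continuous φ ∧
    (∀ x, 0 ≤ φ x) ∧ (∀ x, φ x ≤ A) ∧ (∀ x, ‖x‖ ≤ 1/2 → φ x = A) := by
  let b : ContDiffBump (0 : En n) := ⟨1/2, 1, by norm_num, by norm_num⟩
  have hI : 0 < ∫ x, b x := b.integral_pos
  refine ⟨b.normed volume, (∫ x, b x)⁻¹, ⟨b.contDiff_normed, ?_, b.integral_normed⟩,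
    inv_pos.2 hI, b.continuous_normed, b.nonneg_normed, ?_, ?_⟩
  · intro x hx
    by_contra h
    have : x ∈ Function.support (b.normed volume) := h
    rw [b.support_normed_eq] at this
    exact hx (ball_subset_closedBall this)
  · intro x
    rw [b.normed_def, div_eq_mul_inv]
    exact mul_le_of_le_one_left (inv_pos.2 hI).le b.le_one
  · intro x hx
    rw [b.normed_def, b.one_of_mem_closedBall (by simpa [b] using hx), one_div]

lemma conv_integrable {n : ℕ} {φ g : En n → ℝ} {A : ℝ} (hc : Continuous φ) (h0 : ∀ x, 0 ≤ φ x)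
    (hA : ∀ x, φ x ≤ A) (hg : Integrable g) (t : ℝ) (x : En n) :
    Integrable (fun y => (t ^ n)⁻¹ * φ (t⁻¹ • (x - y)) * g y) := by
  refine hg.bdd_mul (c := |(t^n)⁻¹| * A) ?_ ?_
  · exact Continuous.aestronglyMeasurable (by fun_prop)
  · refine Eventually.of_forall fun y => ?_
    rw [norm_mul, Real.norm_eq_abs, Real.norm_eq_abs, abs_of_nonneg (h0 _)]
    gcongr
    exact hA _

/-- the measure with density `|g|` -/
def nuOf (n : ℕ) (g : En n → ℝ) : Measure (En n) :=
  volume.withDensity (fun x => ENNReal.ofReal |g x|)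

lemma nuOf_finite {n : ℕ} {g : En n → ℝ} (hg : Integrable g) : IsFiniteMeasure (nuOf n g) :=
  isFiniteMeasure_withDensity_ofReal hg.abs.2

lemma nuOf_apply {n : ℕ} {g : En n → ℝ} (hg : Integrable g) (s : Set (En n)) (hs : MeasurableSet s) :
    nuOf n g s = ENNReal.ofReal (∫ x in s, |g x|) := by
  rw [nuOf, withDensity_apply _ hs, ofReal_integral_eq_lintegral_ofReal hg.abs.integrableOn]
  exact Eventually.of_forall fun x => abs_nonneg _

lemma nuOf_real {n : ℕ} {g : En n → ℝ} (hg : Integrable g) (s : Set (En n)) (hs : MeasurableSet s) :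
    (nuOf n g s).toReal = (∫ x in s, |g x|) := by
  rw [nuOf_apply hg s hs, ENNReal.toReal_ofReal (integral_nonneg fun x => abs_nonneg _)]

lemma nuOf_rn {n : ℕ} {g : En n → ℝ} (hg : Integrable g) :
    (nuOf n g).rnDeriv volume =ᵐ[volume] (fun x => ENNReal.ofReal |g x|) :=
  Measure.rnDeriv_withDensity₀ _ hg.abs.aestronglyMeasurable.aemeasurable.ennreal_ofReal

lemma vol_ball {n : ℕ} (x : En n) {r : ℝ} (hr : 0 ≤ r) :
    volume (closedBall x r) = ENNReal.ofReal (r ^ n) * volume (closedBall (0 : En n) 1) := by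
  rw [Measure.addHaar_closedBall' volume x hr]
  simp

lemma conv_le {n : ℕ} {φ g : En n → ℝ} {A : ℝ} (hc : Continuous φ) (h0 : ∀ x, 0 ≤ φ x)
    (hA : ∀ x, φ x ≤ A) (hs : ∀ x, x ∉ Metric.closedBall (0 : En n) 1 → φ x = 0)
    (hg : Integrable g) {t : ℝ} (ht : 0 < t) (x : En n) :
    |phiConv n φ g t x| ≤ (t ^ n)⁻¹ * A * (nuOf n g (closedBall x t)).toReal := by
  rw [nuOf_real hg _ measurableSet_closedBall, phiConv, ← integral_const_mul,
    ← integral_indicator measurableSet_closedBall]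
  refine (abs_integral_le_integral_abs).trans (integral_mono (conv_integrable hc h0 hA hg t x).abs
    ((hg.abs.const_mul _).indicator measurableSet_closedBall) fun y => ?_)
  dsimp only
  by_cases hy : y ∈ closedBall x t
  · rw [indicator_of_mem hy, abs_mul, abs_mul, abs_of_nonneg (h0 _), abs_of_pos (by positivity)]
    gcongr
    exact hA _
  · rw [indicator_of_notMem hy, hs]
    · simp
    · simp only [mem_closedBall, dist_eq_norm, not_le, sub_zero, norm_smul, norm_inv,
        Real.norm_eq_abs, abs_of_pos ht] at hy ⊢
      rw [norm_sub_rev] at hy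
      rw [lt_inv_mul_iff₀ ht]; linarith

lemma ae_bdd {n : ℕ} {φ g : En n → ℝ} {A : ℝ} (hc : Continuous φ) (h0 : ∀ x, 0 ≤ φ x)
    (hA : ∀ x, φ x ≤ A) (hs : ∀ x, x ∉ Metric.closedBall (0 : En n) 1 → φ x = 0)
    (hg : Integrable g) :
    ∀ᵐ x, BddAbove (range fun t : {t : ℝ // 0 < t} => |phiConv n φ g t.1 x|) := by
  have := nuOf_finite hg
  have hA0 : 0 ≤ A := (h0 0).trans (hA 0)
  set v := volume (closedBall (0 : En n) 1) with hv
  have hvt : v ≠ ⊤ := measure_closedBall_lt_top.ne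
  have hv0 : v ≠ 0 := (measure_closedBall_pos _ _ one_pos).ne'
  filter_upwards [Besicovitch.ae_tendsto_rnDeriv (nuOf n g) volume,
    Measure.rnDeriv_lt_top (nuOf n g) volume] with x hx hfin
  obtain ⟨C, hC1, hC⟩ := ENNReal.lt_iff_exists_nnreal_btwn.1 hfin
  have h1 := hx.eventually (gt_mem_nhds hC1)
  obtain ⟨δ, hδ, hδ2⟩ := (mem_nhdsGT_iff_exists_Ioo_subset).1 h1
  have hδ : 0 < δ := hδ
  refine ⟨max (A * (C * v.toReal)) ((δ ^ n)⁻¹ * A * (nuOf n g univ).toReal), ?_⟩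
  rintro _ ⟨⟨t, ht⟩, rfl⟩
  refine (conv_le hc h0 hA hs hg ht x).trans ?_
  rcases lt_or_ge t δ with h | h
  · refine le_max_of_le_left ?_
    have h3 : nuOf n g (closedBall x t) / volume (closedBall x t) < C := hδ2 ⟨ht, h⟩
    have h4 := (ENNReal.div_le_iff (measure_closedBall_pos _ _ ht).ne'
      measure_closedBall_lt_top.ne).1 h3.le
    rw [vol_ball x ht.le] at h4
    have h5 := ENNReal.toReal_mono (by finiteness) h4
    simp only [ENNReal.toReal_mul, ENNReal.coe_toReal, ENNReal.toReal_ofReal (pow_nonneg ht.le n)] at h5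
    calc (t ^ n)⁻¹ * A * (nuOf n g (closedBall x t)).toReal
        ≤ (t ^ n)⁻¹ * A * (C * (t ^ n * v.toReal)) := by gcongr
      _ = _ := by field_simp
  · refine le_max_of_le_right ?_
    gcongr
    · finiteness
    · exact subset_univ _

lemma log_layer {n : ℕ} (ν : Measure (En n)) (F : En n → ℝ) (hF : ∀ x, 0 ≤ F x)
    (hm : AEMeasurable F ν) :
    ∫⁻ x, ENNReal.ofReal (Real.log (1 + F x)) ∂ν =
      ∫⁻ t in Ioi (0:ℝ), ν {x | t < F x} * ENNReal.ofReal ((1 + |t|)⁻¹) := by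
  rw [← lintegral_comp_eq_lintegral_meas_lt_mul ν (Eventually.of_forall hF) hm]
  · refine lintegral_congr fun x => ?_
    congr 1
    have : ∫ t in (0:ℝ)..F x, (1 + |t|)⁻¹ = ∫ t in (0:ℝ)..F x, (1 + t)⁻¹ := by
      refine intervalIntegral.integral_congr fun t ht => ?_
      rw [uIcc_of_le (hF x)] at ht
      simp only [abs_of_nonneg ht.1]
    rw [this, intervalIntegral.integral_comp_add_left (fun t => t⁻¹), integral_inv]
    · simp
    · rw [uIcc_of_le (by linarith [hF x])]
      intro h; linarith [h.1]
  · intro t ht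
    refine Continuous.intervalIntegrable ?_ _ _
    exact Continuous.inv₀ (by fun_prop) (fun x => by positivity)
  · exact Eventually.of_forall fun t => by positivity

lemma rev_weak {n : ℕ} (hn : 1 ≤ n) (ν : Measure (En n)) [IsFiniteMeasure ν] (hac : ν ≪ volume)
    (L : ENNReal) (hL0 : L ≠ 0) (hLt : L ≠ ⊤) (S : Set (En n))
    (hS : ∀ x r, 0 < r → L * volume (closedBall x r) ≤ ν (closedBall x r) →
      ∀ᵐ y, y ∈ closedBall x r → y ∈ S) :
    ν {x | L < ν.rnDeriv volume x} ≤ L * 5 ^ n * volume S := by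
  set v := volume (closedBall (0 : En n) 1) with hv
  have hvt : v ≠ ⊤ := measure_closedBall_lt_top.ne
  have hv0 : v ≠ 0 := (measure_closedBall_pos _ _ one_pos).ne'
  set R := max 1 (ν univ / (L * v)).toReal with hR
  have hbd : ∀ x r, 0 < r → L * volume (closedBall x r) ≤ ν (closedBall x r) → r ≤ R := by
    intro x r hr h
    rcases le_or_gt r 1 with h1 | h1
    · exact h1.trans (le_max_left _ _)
    · refine le_trans ?_ (le_max_right _ _)
      rw [← ENNReal.ofReal_le_iff_le_toReal, ENNReal.le_div_iff_mul_le]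
      · rw [vol_ball x hr.le] at h
        calc ENNReal.ofReal r * (L * v) ≤ ENNReal.ofReal (r ^ n) * (L * v) := by
              gcongr; exact le_self_pow₀ h1.le (by omega)
          _ = L * (ENNReal.ofReal (r ^ n) * v) := by ring
          _ ≤ _ := h.trans (measure_mono (subset_univ _))
      · left; exact mul_ne_zero hL0 hv0
      · left; finiteness
      · exact ENNReal.div_ne_top (by finiteness) (mul_ne_zero hL0 hv0)
  let T : Set (En n) := {x | L < ν.rnDeriv volume x ∧
     Tendsto (fun r => ν (closedBall x r) / volume (closedBall x r)) (𝓝[>] 0) (𝓝 (ν.rnDeriv volume x))}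
  have hsel : ∀ x ∈ T, ∃ r, 0 < r ∧ L * volume (closedBall x r) ≤ ν (closedBall x r) ∧
      ν (closedBall x (5 * r)) ≤ L * volume (closedBall x (5 * r)) := by
    rintro x ⟨hx1, hx2⟩
    let P : Set ℝ := {r | 0 < r ∧ L * volume (closedBall x r) ≤ ν (closedBall x r)}
    have hPb : BddAbove P := ⟨R, fun r hr => hbd x r hr.1 hr.2⟩
    obtain ⟨r0, hr0, hr0'⟩ : P.Nonempty := by
      have h1 := (hx2.eventually (lt_mem_nhds hx1)).and self_mem_nhdsWithin
      obtain ⟨r, hr, hr'⟩ := h1.exists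
      have hr' : 0 < r := hr'
      refine ⟨r, hr', ?_⟩
      exact (ENNReal.le_div_iff_mul_le (Or.inl (measure_closedBall_pos _ _ hr').ne')
        (Or.inl measure_closedBall_lt_top.ne)).1 hr.le
    have hs : 0 < sSup P := hr0.trans_le (le_csSup hPb ⟨hr0, hr0'⟩)
    obtain ⟨r, hr, hlt⟩ := exists_lt_of_lt_csSup (show P.Nonempty from ⟨r0, hr0, hr0'⟩) (show sSup P / 5 < sSup P by linarith)
    refine ⟨r, hr.1, hr.2, ?_⟩
    by_contra! hcon
    have : 5 * r ∈ P := ⟨by linarith [hr.1], hcon.le⟩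
    linarith [le_csSup hPb this]
  choose! ρ hρ0 hρ1 hρ2 using hsel
  obtain ⟨u, huT, hdis, hcov⟩ := Vitali.exists_disjoint_subfamily_covering_enlargement_closedBall
    T (fun x => x) ρ R (fun a ha => hbd _ _ (hρ0 a ha) (hρ1 a ha)) 5 (by norm_num)
  have hcount : u.Countable := hdis.countable_of_nonempty_interior fun a ha =>
    ⟨a, ball_subset_interior_closedBall (mem_ball_self (hρ0 a (huT ha)))⟩
  have h1 : ν {x | L < ν.rnDeriv volume x} ≤ ν T := by
    refine measure_mono_ae ?_
    filter_upwards [hac (Besicovitch.ae_tendsto_rnDeriv ν volume)] with x hx hx2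
    exact ⟨hx2, hx⟩
  have h2 : ν T ≤ ν (⋃ a ∈ u, closedBall a (5 * ρ a)) := by
    refine measure_mono fun x hx => ?_
    obtain ⟨b, hb, hb2⟩ := hcov x hx
    exact mem_biUnion hb (hb2 (mem_closedBall_self (hρ0 x hx).le))
  have := hcount.to_subtype
  calc _ ≤ ν (⋃ a ∈ u, closedBall a (5 * ρ a)) := h1.trans h2
    _ ≤ ∑' a : u, ν (closedBall (a : En n) (5 * ρ a)) := measure_biUnion_le _ hcount _
    _ ≤ ∑' a : u, L * 5 ^ n * volume (closedBall (a : En n) (ρ a)) := by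
        refine ENNReal.tsum_le_tsum fun a => (hρ2 a (huT a.2)).trans_eq ?_
        have hp := hρ0 a (huT a.2)
        rw [vol_ball _ (by positivity), vol_ball _ hp.le, mul_pow, ENNReal.ofReal_mul (by positivity)]
        rw [ENNReal.ofReal_pow (by norm_num)]
        simp only [ENNReal.ofReal_ofNat]
        ring
    _ = L * 5 ^ n * volume (⋃ a ∈ u, closedBall a (ρ a)) := by
        rw [ENNReal.tsum_mul_left, measure_biUnion hcount hdis fun _ _ => measurableSet_closedBall]
    _ ≤ _ := by
        gcongr 1
        refine measure_mono_ae ?_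
        have : ∀ᵐ y, ∀ a ∈ u, y ∈ closedBall a (ρ a) → y ∈ S :=
          (ae_ball_iff hcount).2 fun a ha => hS a _ (hρ0 a (huT ha)) (hρ1 a (huT ha))
        filter_upwards [this] with y hy hy2
        obtain ⟨a, ha, hay⟩ := mem_iUnion₂.1 hy2
        exact hy a ha hay

lemma conv_ge {n : ℕ} {φ g : En n → ℝ} {A : ℝ} (hc : Continuous φ) (h0 : ∀ x, 0 ≤ φ x)
    (hA : ∀ x, φ x ≤ A) (hpl : ∀ x, ‖x‖ ≤ 1/2 → φ x = A)
    (hg : Integrable g) (hg0 : ∀ x, 0 ≤ g x) {t : ℝ} (ht : 0 < t) (x : En n) :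
    (t ^ n)⁻¹ * A * (nuOf n g (closedBall x (t/2))).toReal ≤ phiConv n φ g t x := by
  rw [nuOf_real hg _ measurableSet_closedBall, phiConv, ← integral_const_mul,
    ← integral_indicator measurableSet_closedBall]
  refine (integral_mono ((hg.abs.const_mul _).indicator measurableSet_closedBall)
    (conv_integrable hc h0 hA hg t x) fun y => ?_)
  dsimp only
  by_cases hy : y ∈ closedBall x (t/2)
  · rw [indicator_of_mem hy, abs_of_nonneg (hg0 _), hpl]
    simp only [mem_closedBall, dist_eq_norm, norm_smul, norm_inv,
        Real.norm_eq_abs, abs_of_pos ht] at hy ⊢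
    rw [norm_sub_rev] at hy
    rw [inv_mul_le_iff₀ ht]; linarith
  · rw [indicator_of_notMem hy]
    have := h0 (t⁻¹ • (x - y))
    have := hg0 y
    positivity

lemma unitQ_norm {n : ℕ} (hn : 1 ≤ n) {y : En n} (hy : y ∈ unitQ n) : ‖y‖ ≤ n := by
  have hn' : (1:ℝ) ≤ n := by exact_mod_cast hn
  rw [EuclideanSpace.norm_eq, Real.sqrt_le_left (by positivity)]
  calc ∑ i, ‖y i‖ ^ 2 ≤ ∑ i : Fin n, (1:ℝ) := by
        refine Finset.sum_le_sum fun i _ => ?_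
        have := hy i
        rw [Real.norm_eq_abs, sq_abs]
        nlinarith
    _ = n := by simp
    _ ≤ (n:ℝ)^2 := by nlinarith

lemma theta_integrable {n : ℕ} (hn : 1 ≤ n) {θ : En n → ℝ} (hm : Measurable θ) {C : ℝ}
    (hC : ∀ x, |θ x| ≤ C) (hs : ∀ x, x ∉ unitQ n → θ x = 0) : Integrable θ := by
  have h : IntegrableOn θ (closedBall 0 n) :=
    Measure.integrableOn_of_bounded (M := C) measure_closedBall_lt_top.ne hm.aestronglyMeasurable
      (Eventually.of_forall hC)
  refine (integrableOn_iff_integrable_of_support_subset fun x hx => ?_).1 h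
  by_contra h2
  refine hx (hs x fun hq => h2 ?_)
  simpa using unitQ_norm hn hq

lemma nuOf_bdd {n : ℕ} {θ : En n → ℝ} (hi : Integrable θ) {C : ℝ}
    (hC : ∀ x, |θ x| ≤ C) (x : En n) {t : ℝ} (ht : 0 ≤ t) :
    (nuOf n θ (closedBall x t)).toReal ≤ C * (t ^ n * (volume (closedBall (0 : En n) 1)).toReal) := by
  rw [nuOf_real hi _ measurableSet_closedBall]
  have := setIntegral_mono_on (s := closedBall x t) hi.abs.integrableOn
    (integrableOn_const (C := C) measure_closedBall_lt_top.ne) measurableSet_closedBall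
    (fun x _ => hC x)
  refine this.trans_eq ?_
  rw [setIntegral_const, measureReal_def, vol_ball x ht, ENNReal.toReal_mul,
    ENNReal.toReal_ofReal (pow_nonneg ht n), smul_eq_mul, mul_comm]

lemma phiConv_sub {n : ℕ} {φ f θ : En n → ℝ} {A : ℝ} (hc : Continuous φ) (h0 : ∀ x, 0 ≤ φ x)
    (hA : ∀ x, φ x ≤ A) (hf : Integrable f) (hθ : Integrable θ) (c t : ℝ) (x : En n) :
    phiConv n φ (fun x => f x - c * θ x) t x = phiConv n φ f t x - c * phiConv n φ θ t x := by
  simp only [phiConv]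
  rw [← integral_const_mul, ← integral_sub (conv_integrable hc h0 hA hf t x)
    ((conv_integrable hc h0 hA hθ t x).const_mul c)]
  congr 1; ext y; ring

lemma part_one {n : ℕ} (hn : 1 ≤ n) {φ f θ : En n → ℝ} {A C : ℝ} (hA0 : 0 < A) (hc : Continuous φ)
    (h0 : ∀ x, 0 ≤ φ x) (hA : ∀ x, φ x ≤ A)
    (hs : ∀ x, x ∉ Metric.closedBall (0 : En n) 1 → φ x = 0)
    (hpl : ∀ x, ‖x‖ ≤ 1/2 → φ x = A)
    (hf : Integrable f) (hf0 : ∀ x, 0 ≤ f x) (hθ : Integrable θ) (hC : ∀ x, |θ x| ≤ C)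
    (hM : Integrable (Mphi n φ (fun x => f x - (∫ y, f y) * θ x))) :
    ∫⁻ x, ENNReal.ofReal (Real.log (1 + f x)) ∂(nuOf n f) < ⊤ := by
  have := nuOf_finite hf
  set c := ∫ y, f y with hcdef
  have hc0 : 0 ≤ c := integral_nonneg hf0
  have hC0 : 0 ≤ C := (abs_nonneg _).trans (hC 0)
  set g := (fun x => f x - c * θ x) with hg
  have hgi : Integrable g := hf.sub (hθ.const_mul c)
  set v := volume (closedBall (0 : En n) 1) with hv
  have hvt : v ≠ ⊤ := measure_closedBall_lt_top.ne
  have hv0 : v ≠ 0 := (measure_closedBall_pos _ _ one_pos).ne'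
  have hvr : 0 < v.toReal := ENNReal.toReal_pos hv0 hvt
  have hac : nuOf n f ≪ volume := withDensity_absolutelyContinuous _ _
  set κ := A * v.toReal * (4 ^ n)⁻¹ / 2 with hκ
  have hκ0 : 0 < κ := by positivity
  set l0 := 2 * 4 ^ n * c * C with hl0
  have hl00 : 0 ≤ l0 := by positivity
  have hae := ae_bdd hc h0 hA hs hgi
  have key : ∀ l : ℝ, 0 < l → l0 < l → nuOf n f {x | l < f x} ≤
      ENNReal.ofReal l * 5 ^ n * volume {y | l ≤ κ⁻¹ * Mphi n φ g y} := by
    intro l hl hl2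
    refine le_trans ?_ (rev_weak hn (nuOf n f) hac (ENNReal.ofReal l) (by simpa using hl)
      ENNReal.ofReal_ne_top _ ?_)
    · refine measure_mono_ae ?_
      filter_upwards [hac (nuOf_rn hf)] with x hx hx2
      have hx2 : l < f x := hx2
      change _ < _
      rw [show (nuOf n f).rnDeriv volume x = _ from hx, abs_of_nonneg (hf0 x)]
      exact (ENNReal.ofReal_lt_ofReal_iff (hl.trans hx2)).2 hx2
    · intro x r hr hxr
      filter_upwards [hae] with y hy hyx
      have hsub : closedBall x r ⊆ closedBall y (4 * r / 2) := by
        intro z hz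
        simp only [mem_closedBall] at *
        linarith [dist_triangle z x y, dist_comm x y]
      have h1 := conv_ge hc h0 hA hpl hf hf0 (show 0 < 4 * r by positivity) y
      have h2 := conv_le hc h0 hA hs hθ (show 0 < 4 * r by positivity) y
      have h3 := nuOf_bdd hθ hC y (show 0 ≤ 4 * r by positivity)
      have h4 : l * (r ^ n * v.toReal) ≤ (nuOf n f (closedBall y (4 * r / 2))).toReal := by
        have h5 := hxr.trans (measure_mono hsub)
        rw [vol_ball x hr.le] at h5
        have h6 := ENNReal.toReal_mono (by finiteness) h5
        simpa only [ENNReal.toReal_mul, ENNReal.toReal_ofReal (pow_nonneg hr.le n),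
          ENNReal.toReal_ofReal hl.le] using h6
      have h7 : |phiConv n φ θ (4 * r) y| ≤ A * C * v.toReal := by
        refine h2.trans ?_
        calc _ ≤ ((4 * r) ^ n)⁻¹ * A * (C * ((4 * r) ^ n * v.toReal)) := by gcongr
          _ = _ := by field_simp
      have h8 : A * (4 ^ n)⁻¹ * v.toReal * l ≤ phiConv n φ f (4 * r) y := by
        refine le_trans ?_ h1
        calc _ = ((4 * r) ^ n)⁻¹ * A * (l * (r ^ n * v.toReal)) := by
              rw [mul_pow]; field_simp
          _ ≤ _ := by gcongr
      have h9 : phiConv n φ g (4 * r) y ≤ Mphi n φ g y :=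
        (le_abs_self _).trans (le_ciSup hy ⟨4 * r, by positivity⟩)
      rw [hg, phiConv_sub hc h0 hA hf hθ] at h9
      have h10 : c * phiConv n φ θ (4 * r) y ≤ c * (A * C * v.toReal) := by
        gcongr; exact (le_abs_self _).trans h7
      change l ≤ κ⁻¹ * _
      rw [le_inv_mul_iff₀ hκ0]
      refine le_trans ?_ h9
      have h11 : c * (A * C * v.toReal) = κ * l0 := by
        rw [hκ, hl0]; field_simp
      have h12 : A * (4 ^ n)⁻¹ * v.toReal * l = 2 * (κ * l) := by rw [hκ]; ring
      have h13 : κ * l0 ≤ κ * l := by gcongr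
      linarith
  rw [log_layer _ f hf0 (hf.aestronglyMeasurable.aemeasurable.mono_ac hac)]
  have hMn : ∀ y, 0 ≤ Mphi n φ g y := fun y => Real.iSup_nonneg fun t => abs_nonneg _
  have hle : ∀ t ∈ Ioi (0:ℝ), nuOf n f {x | t < f x} * ENNReal.ofReal ((1 + |t|)⁻¹) ≤
      (Iic l0).indicator (fun _ => nuOf n f univ) t +
        5 ^ n * volume {y | t ≤ κ⁻¹ * Mphi n φ g y} := by
    intro t ht
    have ht : 0 < t := ht
    rcases le_or_gt t l0 with h | h
    · rw [indicator_of_mem (show t ∈ Iic l0 from h)]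
      refine le_add_right ?_
      refine (mul_le_mul' (measure_mono (subset_univ _)) (ENNReal.ofReal_le_one.2 ?_)).trans_eq
        (mul_one _)
      exact inv_le_one_of_one_le₀ (by linarith [abs_nonneg t])
    · refine le_add_left ?_
      refine (mul_le_mul_left (key t ht h) _).trans ?_
      have : ENNReal.ofReal t * ENNReal.ofReal ((1 + |t|)⁻¹) ≤ 1 := by
        rw [← ENNReal.ofReal_mul ht.le, abs_of_pos ht]
        refine ENNReal.ofReal_le_one.2 ?_
        rw [mul_inv_le_iff₀ (by positivity)]; linarith
      calc _ = (ENNReal.ofReal t * ENNReal.ofReal ((1 + |t|)⁻¹)) *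
            (5 ^ n * volume {y | t ≤ κ⁻¹ * Mphi n φ g y}) := by ring
        _ ≤ 1 * (5 ^ n * volume {y | t ≤ κ⁻¹ * Mphi n φ g y}) := by gcongr
        _ = _ := one_mul _
  refine (setLIntegral_mono' measurableSet_Ioi hle).trans_lt ?_
  rw [lintegral_add_left (measurable_const.indicator measurableSet_Iic),
    lintegral_const_mul' _ _ (by finiteness),
    ← lintegral_eq_lintegral_meas_le volume
      (Eventually.of_forall fun y => mul_nonneg (inv_pos.2 hκ0).le (hMn y))
      (hM.const_mul κ⁻¹).aestronglyMeasurable.aemeasurable]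
  refine ENNReal.add_lt_top.2 ⟨?_, ENNReal.mul_lt_top (by finiteness)
    (hM.const_mul κ⁻¹).lintegral_lt_top⟩
  rw [lintegral_indicator measurableSet_Iic, setLIntegral_const, Measure.restrict_apply measurableSet_Iic]
  refine ENNReal.mul_lt_top (measure_lt_top _ _) ?_
  rw [inter_comm, Ioi_inter_Iic, Real.volume_Ioc]
  exact ENNReal.ofReal_lt_top

lemma part_two {n : ℕ} (hn : 1 ≤ n) {φ f θ : En n → ℝ} {A : ℝ} (hA0 : 0 < A) (hc : Continuous φ)
    (h0 : ∀ x, 0 ≤ φ x) (hA : ∀ x, φ x ≤ A)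
    (hs : ∀ x, x ∉ Metric.closedBall (0 : En n) 1 → φ x = 0)
    (hpl : ∀ x, ‖x‖ ≤ 1/2 → φ x = A)
    (hf : Integrable f) (hf0 : ∀ x, 0 ≤ f x) (hθ : Integrable θ)
    (hθs : ∀ x, x ∉ unitQ n → θ x = 0) (hθ1 : (∫ x, θ x) = 1)
    (hM : Integrable (Mphi n φ (fun x => f x - (∫ y, f y) * θ x))) :
    ∫⁻ x, ENNReal.ofReal (Real.log (1 + ‖x‖ / 5)) ∂(nuOf n f) < ⊤ := by
  have := nuOf_finite hf
  have hn' : (1:ℝ) ≤ n := by exact_mod_cast hn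
  set c := ∫ y, f y with hcdef
  set g := (fun x => f x - c * θ x) with hg
  have hgi : Integrable g := hf.sub (hθ.const_mul c)
  have hae := ae_bdd hc h0 hA hs hgi
  let N : ℝ → ℝ := fun r => (nuOf n f {y | 5 * r < ‖y‖}).toReal
  have hNm : Antitone N := fun a b hab =>
    ENNReal.toReal_mono (by finiteness) (measure_mono fun y (hy : 5 * b < ‖y‖) => by
      change 5 * a < ‖y‖; linarith)
  have hN0 : ∀ r, 0 ≤ N r := fun r => ENNReal.toReal_nonneg
  let G : ℝ → ℝ := (Ici (n:ℝ)).indicator fun r => ((4 * r) ^ n)⁻¹ * A * N r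
  have hGm : Measurable G := by
    refine Measurable.indicator ?_ measurableSet_Ici
    exact Measurable.mul (by fun_prop) hNm.measurable
  have hMn : ∀ y, 0 ≤ Mphi n φ g y := fun y => Real.iSup_nonneg fun t => abs_nonneg _
  have hGi : Integrable (fun x : En n => G ‖x‖) := by
    refine hM.mono' (hGm.comp measurable_norm).aestronglyMeasurable ?_
    filter_upwards [hae] with x hx
    by_cases hxn : (n:ℝ) ≤ ‖x‖
    · have hx0 : 0 < ‖x‖ := by linarith
      have hp : 0 < 4 * ‖x‖ := by positivity
      simp only [G, indicator_of_mem (show ‖x‖ ∈ Ici (n:ℝ) from hxn)]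
      rw [Real.norm_eq_abs, abs_of_nonneg (by have := hN0 ‖x‖; positivity)]
      refine le_trans ?_ (le_ciSup hx ⟨4 * ‖x‖, hp⟩)
      dsimp only
      rw [hg, phiConv_sub hc h0 hA hf hθ]
      have e1 : phiConv n φ θ (4 * ‖x‖) x = ((4 * ‖x‖) ^ n)⁻¹ * A := by
        have : phiConv n φ θ (4 * ‖x‖) x = ∫ y, ((4 * ‖x‖) ^ n)⁻¹ * A * θ y := by
          refine integral_congr_ae (Eventually.of_forall fun y => ?_)
          dsimp only
          by_cases hy : y ∈ unitQ n
          · rw [hpl]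
            rw [norm_smul, norm_inv, Real.norm_eq_abs, abs_of_pos hp, inv_mul_le_iff₀ hp]
            linarith [norm_sub_le x y, unitQ_norm hn hy]
          · rw [hθs y hy]; simp
        rw [this, integral_const_mul, hθ1, mul_one]
      have e2 : c * (((4 * ‖x‖) ^ n)⁻¹ * A) = ∫ y, ((4 * ‖x‖) ^ n)⁻¹ * A * f y := by
        rw [integral_const_mul, mul_comm]
      rw [e1, e2, phiConv, abs_sub_comm, ← integral_sub (hf.const_mul _)
        (conv_integrable hc h0 hA hf _ x)]
      refine le_trans ?_ (le_abs_self _)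
      have hms : MeasurableSet {y : En n | 5 * ‖x‖ < ‖y‖} :=
        measurableSet_lt measurable_const measurable_norm
      simp only [N]
      rw [nuOf_real hf _ hms, ← integral_const_mul, ← integral_indicator hms]
      refine integral_mono ((hf.abs.const_mul _).indicator hms)
        ((hf.const_mul _).sub (conv_integrable hc h0 hA hf _ x)) fun y => ?_
      dsimp only
      by_cases hy : y ∈ {y : En n | 5 * ‖x‖ < ‖y‖}
      · rw [indicator_of_mem hy, hs, abs_of_nonneg (hf0 y)]
        · simp
        · have hy : 5 * ‖x‖ < ‖y‖ := hy
          rw [mem_closedBall, dist_zero_right, not_le, norm_smul, norm_inv, Real.norm_eq_abs,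
            abs_of_pos hp, lt_inv_mul_iff₀ hp]
          linarith [norm_sub_norm_le y x, norm_sub_rev x y]
      · rw [indicator_of_notMem hy]
        have : ((4 * ‖x‖) ^ n)⁻¹ * φ ((4 * ‖x‖)⁻¹ • (x - y)) * f y ≤ ((4 * ‖x‖) ^ n)⁻¹ * A * f y := by
          have := hf0 y
          gcongr
          exact hA _
        linarith
    · simp only [G, indicator_of_notMem (show ‖x‖ ∉ Ici (n:ℝ) from hxn), norm_zero]
      exact hMn x
  have hNon : Nontrivial (En n) := by
    have : Nonempty (Fin n) := ⟨⟨0, hn⟩⟩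
    infer_instance
  have hI : IntegrableOn (fun r : ℝ => r ^ (n - 1) * G r) (Ioi 0) := by
    have := (integrable_fun_norm_addHaar (volume : Measure (En n)) (f := G)).1 hGi
    simpa using this
  rw [log_layer _ (fun x => ‖x‖ / 5) (fun x => by positivity) (by fun_prop)]
  have hle : ∀ t ∈ Ioi (0:ℝ), nuOf n f {x | t < ‖x‖ / 5} * ENNReal.ofReal ((1 + |t|)⁻¹) ≤
      (Iic (n:ℝ)).indicator (fun _ => nuOf n f univ) t +
        ENNReal.ofReal ((4 ^ n / A) * (t ^ (n - 1) * G t)) := by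
    intro t ht
    have ht : 0 < t := ht
    rcases le_or_gt t n with h | h
    · rw [indicator_of_mem (show t ∈ Iic (n:ℝ) from h)]
      refine le_add_right ?_
      refine (mul_le_mul' (measure_mono (subset_univ _)) (ENNReal.ofReal_le_one.2 ?_)).trans_eq
        (mul_one _)
      exact inv_le_one_of_one_le₀ (by linarith [abs_nonneg t])
    · refine le_add_left ?_
      simp only [G, indicator_of_mem (show t ∈ Ici (n:ℝ) from h.le)]
      have e : (4 ^ n / A) * (t ^ (n - 1) * (((4 * t) ^ n)⁻¹ * A * N t)) = N t * t⁻¹ := by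
        obtain ⟨m, rfl⟩ : ∃ m, n = m + 1 := ⟨n - 1, by omega⟩
        rw [mul_pow, Nat.add_sub_cancel, pow_succ t m]
        field_simp
      rw [e, ENNReal.ofReal_mul (hN0 t)]
      have e2 : {x : En n | t < ‖x‖ / 5} = {y | 5 * t < ‖y‖} := by
        ext y; simp only [mem_ofPred_eq]; constructor <;> intro h <;> linarith
      rw [e2, ENNReal.ofReal_toReal (by finiteness)]
      gcongr
      rw [abs_of_pos ht]; linarith
  refine (setLIntegral_mono' measurableSet_Ioi hle).trans_lt ?_
  rw [lintegral_add_left (measurable_const.indicator measurableSet_Iic)]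
  refine ENNReal.add_lt_top.2 ⟨?_, (hI.const_mul _).lintegral_lt_top⟩
  rw [lintegral_indicator measurableSet_Iic, setLIntegral_const, Measure.restrict_apply measurableSet_Iic]
  refine ENNReal.mul_lt_top (measure_lt_top _ _) ?_
  rw [inter_comm, Ioi_inter_Iic, Real.volume_Ioc]
  exact ENNReal.ofReal_lt_top

/-- **Necessity in the global Stein theorem for `H^1`.**
If `f` is a nonnegative integrable function such that `T_θ f = f - (∫ f) θ`
belongs to `H^1(ℝ^n)`, then `∫ f(x) (1 + ln₊ f(x) + ln₊|x|) dx < ∞`. -/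
theorem global_stein_H1_necessity (n : ℕ) (hn : 1 ≤ n) (θ f : En n → ℝ)
    (hθmeas : Measurable θ) (hθbdd : ∃ C, ∀ x, |θ x| ≤ C)
    (hθsupp : ∀ x, x ∉ unitQ n → θ x = 0) (hθint : (∫ x, θ x) = 1)
    (hf : Integrable f) (hf0 : ∀ x, 0 ≤ f x)
    (hH1 : MemH1 n (fun x => f x - (∫ y, f y) * θ x)) :
    ∫⁻ x, ENNReal.ofReal (f x * (1 + lnp (f x) + lnp ‖x‖)) < ⊤ := by
  obtain ⟨C, hC⟩ := hθbdd
  obtain ⟨φ, A, hφ, hA0, hc, h0, hA, hpl⟩ := exists_bump n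
  have hθ := theta_integrable hn hθmeas hC hθsupp
  have hM := hH1 φ hφ
  have h1 := part_one hn hA0 hc h0 hA hφ.2.1 hpl hf hf0 hθ hC hM
  have h2 := part_two hn hA0 hc h0 hA hφ.2.1 hpl hf hf0 hθ hθsupp hθint hM
  have := nuOf_finite hf
  have hfm := hf.aestronglyMeasurable.aemeasurable
  have hac : nuOf n f ≪ volume := withDensity_absolutelyContinuous _ _
  have hm2 : Measurable fun x : En n => ENNReal.ofReal (Real.log (1 + ‖x‖ / 5)) := by fun_prop
  have hm1 : AEMeasurable (fun x : En n => ENNReal.ofReal (Real.log (1 + f x))) volume := by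
    fun_prop
  have hl5 : 0 ≤ Real.log 5 := Real.log_nonneg (by norm_num)
  have h3 : ∫⁻ x, (ENNReal.ofReal (Real.log (1 + f x)) + ENNReal.ofReal (Real.log (1 + ‖x‖ / 5)) +
      ENNReal.ofReal (1 + Real.log 5)) ∂(nuOf n f) < ⊤ := by
    rw [lintegral_add_right _ measurable_const, lintegral_add_right _ hm2, lintegral_const]
    exact ENNReal.add_lt_top.2 ⟨ENNReal.add_lt_top.2 ⟨h1, h2⟩,
      ENNReal.mul_lt_top ENNReal.ofReal_lt_top (measure_lt_top _ _)⟩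
  have hm3 : AEMeasurable (fun x : En n => ENNReal.ofReal (Real.log (1 + f x)) +
      ENNReal.ofReal (Real.log (1 + ‖x‖ / 5)) + ENNReal.ofReal (1 + Real.log 5)) volume :=
    (hm1.add hm2.aemeasurable).add aemeasurable_const
  rw [nuOf, lintegral_withDensity_eq_lintegral_mul₀ hfm.abs.ennreal_ofReal hm3] at h3
  refine (lintegral_mono fun x => ?_).trans_lt h3
  have hx := norm_nonneg x
  have hl1 : 0 ≤ Real.log (1 + f x) := Real.log_nonneg (by linarith [hf0 x])
  have hl2 : 0 ≤ Real.log (1 + ‖x‖ / 5) := Real.log_nonneg (by linarith)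
  rw [Pi.mul_apply, abs_of_nonneg (hf0 x), ← ENNReal.ofReal_add hl1 hl2,
    ← ENNReal.ofReal_add (by positivity) (by positivity), ← ENNReal.ofReal_mul (hf0 x)]
  refine ENNReal.ofReal_le_ofReal (mul_le_mul_of_nonneg_left ?_ (hf0 x))
  have e1 : lnp (f x) ≤ Real.log (1 + f x) := by
    refine max_le ?_ hl1
    rcases (hf0 x).eq_or_lt with h | h
    · rw [← h]; simp
    · exact Real.log_le_log h (by linarith)
  have e2 : lnp ‖x‖ ≤ Real.log (1 + ‖x‖ / 5) + Real.log 5 := by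
    refine max_le ?_ (by positivity)
    rcases hx.eq_or_lt with h | h
    · rw [← h]; simpa using hl5
    · rw [← Real.log_mul (by positivity) (by norm_num)]
      exact Real.log_le_log h (by linarith)
  linarith
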